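/- Let G be a countably infinite discrete amenable group, let A be a finite set, and let X ⊆ A^G be a subshift. Fix a tempered Følner sequence {F_n} of G with F_1 ⊆ F_2 ⊆ ⋯ and ⋃_n F_n = G, and let d be the associated metric on A^G. Then the Hausdorff dimension of X with respect to d equals the topological entropy: dim(X) = h_top(X,G). -/

import Mathlib

open Filter Topology Pointwise Set
open scoped ENNReal NNReal

attribute [local instance] Classical.propDecidable

section Defs

variable {G : Type*} [Group G] [DecidableEq G]

/-- `F` is a (left) Følner sequence: each `F n` is nonempty and
`|F n ∆ gF n| / |F n| → 0` for every `g ∈ G`. -/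
def IsFolnerSeq (F : ℕ → Finset G) : Prop :=
  (∀ n, (F n).Nonempty) ∧
    ∀ g : G, Filter.Tendsto
      (fun n => ((symmDiff (F n) ((F n).image (fun h => g * h))).card : ℝ) / ((F n).card : ℝ))
      Filter.atTop (nhds 0)

/-- `F` is tempered: there is `C > 0` with `|⋃_{k<n} (F k)⁻¹ (F n)| ≤ C |F n|` for all `n`. -/
def IsTemperedSeq (F : ℕ → Finset G) : Prop :=
  ∃ C : ℝ, 0 < C ∧ ∀ n : ℕ,
    ((((Finset.range n).biUnion fun k => (F k)⁻¹ * F n)).card : ℝ) ≤ C * ((F n).card : ℝ)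

variable {A : Type*}

/-- The (left) shift action of `G` on `A^G`: `(g' • x) g = x (g g')`. -/
def shift (g' : G) (x : G → A) : G → A := fun g => x (g * g')

/-- A subshift: a closed shift-invariant subset of `A^G` (with the product topology). -/
def IsSubshift [TopologicalSpace A] (X : Set (G → A)) : Prop :=
  IsClosed X ∧ ∀ g : G, ∀ x ∈ X, shift g x ∈ X

/-- The metric on `A^G` associated to a nested Følner sequence exhausting `G`:
`d(x,x) = 0`; `d(x,y) = 1` if `x` and `y` are not equal on `F 0`; otherwise
`d(x,y) = e^{-|F n|}` where `n` is the maximal index such that `x` and `y` agree on `F n`. -/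
noncomputable def subshiftDist (Fseq : ℕ → Finset G) (x y : G → A) : ℝ :=
  if x = y then 0
  else if ∀ g ∈ Fseq 0, x g = y g then
    Real.exp (-((Fseq (sSup {n : ℕ | ∀ g ∈ Fseq n, x g = y g})).card : ℝ))
  else 1

/-- The diameter of a subset of `A^G` with respect to the metric `subshiftDist`. -/
noncomputable def sdiam (Fseq : ℕ → Finset G) (E : Set (G → A)) : ℝ≥0∞ :=
  ⨆ (x : E) (y : E), ENNReal.ofReal (subshiftDist Fseq (x : G → A) (y : G → A))

/-- The `s`-dimensional Hausdorff (outer) measure of `X ⊆ A^G` for the metric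
`subshiftDist`: `μ_s(X) = lim_{ε→0} inf_𝓔 ∑_{E∈𝓔} diam(E)^s`, the infimum over countable
covers `𝓔` of `X` by sets of diameter at most `ε` (the infimum is nondecreasing as `ε`
decreases, so the limit is the supremum over `ε > 0`). -/
noncomputable def hMeasure (Fseq : ℕ → Finset G) (s : ℝ) (X : Set (G → A)) : ℝ≥0∞ :=
  ⨆ (ε : ℝ) (_ : 0 < ε),
    ⨅ (𝓔 : Set (Set (G → A))) (_ : 𝓔.Countable) (_ : X ⊆ ⋃₀ 𝓔)
      (_ : ∀ E ∈ 𝓔, sdiam Fseq E ≤ ENNReal.ofReal ε),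
      ∑' E : 𝓔, sdiam Fseq (E : Set (G → A)) ^ s

/-- The Hausdorff dimension `dim(X) = inf {s ≥ 0 : μ_s(X) = 0}`. -/
noncomputable def hDim (Fseq : ℕ → Finset G) (X : Set (G → A)) : ℝ≥0∞ :=
  ⨅ (s : ℝ≥0) (_ : hMeasure Fseq (s : ℝ) X = 0), (s : ℝ≥0∞)

/-- The set `X(U) = ⋂_{g ∈ F} g⁻¹ U_g` associated to a `(𝒰,F)`-name `u`, for the shift
action. -/
def nameSet (F : Finset G) (u : G → Set (G → A)) : Set (G → A) :=
  {x : G → A | ∀ g ∈ F, shift g x ∈ u g}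

/-- `𝒰` is a finite open cover of the set `Z`. -/
def IsFiniteOpenCoverOn [TopologicalSpace A] (𝒰 : Finset (Set (G → A))) (Z : Set (G → A)) :
    Prop :=
  (∀ V ∈ 𝒰, IsOpen V) ∧ Z ⊆ ⋃₀ (𝒰 : Set (Set (G → A)))

/-- `N(⋁_{g ∈ F} g⁻¹ 𝒰)` relative to `Z`: the minimal cardinality of a family of
`(𝒰,F)`-names whose associated sets cover `Z`. -/
noncomputable def covNum (𝒰 : Finset (Set (G → A))) (F : Finset G) (Z : Set (G → A)) : ℕ :=
  sInf {k : ℕ | ∃ Λ : Finset (G → Set (G → A)), Λ.card = k ∧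
    (∀ u ∈ Λ, ∀ g ∈ F, u g ∈ 𝒰) ∧ Z ⊆ ⋃ u ∈ Λ, nameSet F u}

/-- The entropy of the cover `𝒰` along the Følner sequence `Fseq`,
`lim_n (1/|F n|) log N(⋁_{g ∈ F n} g⁻¹𝒰)` (the limit exists by the Ornstein–Weiss lemma,
so we may express it as a `limsup`). -/
noncomputable def coverEntropyOf (Fseq : ℕ → Finset G) (𝒰 : Finset (Set (G → A)))
    (Z : Set (G → A)) : ℝ≥0∞ :=
  Filter.limsup
    (fun n => ENNReal.ofReal (Real.log (covNum 𝒰 (Fseq n) Z) / ((Fseq n).card : ℝ)))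
    Filter.atTop

/-- The topological entropy of the subshift `X`:
`h_top(X,G) = sup_𝒰 lim_n (1/|F n|) log N(⋁_{g∈F n} g⁻¹𝒰)`,
the supremum over finite open covers `𝒰` of `X`. -/
noncomputable def topEntropy [TopologicalSpace A] (Fseq : ℕ → Finset G)
    (X : Set (G → A)) : ℝ≥0∞ :=
  ⨆ (𝒰 : Finset (Set (G → A))) (_ : IsFiniteOpenCoverOn 𝒰 X), coverEntropyOf Fseq 𝒰 X

/-- `ℳ(Z,𝒰,N,s,{F n})`: the infimum of `∑_{U ∈ Λ} exp(-s·m(U))` over all collections `Λ`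
of `(𝒰, F j)`-names with `j ≥ N` whose associated sets cover `Z`. -/
noncomputable def bowenM (Fseq : ℕ → Finset G) (𝒰 : Finset (Set (G → A)))
    (Z : Set (G → A)) (N : ℕ) (s : ℝ) : ℝ≥0∞ :=
  ⨅ (Λ : Set (ℕ × (G → Set (G → A))))
    (_ : ∀ p ∈ Λ, N ≤ p.1 ∧ ∀ g ∈ Fseq p.1, p.2 g ∈ 𝒰)
    (_ : Z ⊆ ⋃ p ∈ Λ, nameSet (Fseq p.1) p.2),
    ∑' p : Λ, ENNReal.ofReal (Real.exp (-s * ((Fseq p.1.1).card : ℝ)))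

/-- `ℳ(Z,𝒰,s,{F n}) = lim_{N→∞} ℳ(Z,𝒰,N,s,{F n})`; the quantity is nondecreasing in `N`,
so the limit is the supremum. -/
noncomputable def bowenMlim (Fseq : ℕ → Finset G) (𝒰 : Finset (Set (G → A)))
    (Z : Set (G → A)) (s : ℝ) : ℝ≥0∞ :=
  ⨆ N : ℕ, bowenM Fseq 𝒰 Z N s

/-- `h^B_top(𝒰,Z,{F n}) = inf {s ≥ 0 : ℳ(Z,𝒰,s,{F n}) = 0}`. -/
noncomputable def bowenEntropyCover (Fseq : ℕ → Finset G) (𝒰 : Finset (Set (G → A)))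
    (Z : Set (G → A)) : ℝ≥0∞ :=
  ⨅ (s : ℝ≥0) (_ : bowenMlim Fseq 𝒰 Z (s : ℝ) = 0), (s : ℝ≥0∞)

/-- The Bowen (dimensional) topological entropy of the subshift `X`:
`h^B_top(X,{F n}) = sup_𝒰 h^B_top(𝒰,X,{F n})` over finite open covers `𝒰` of `X`. -/
noncomputable def bowenEntropy [TopologicalSpace A] (Fseq : ℕ → Finset G)
    (X : Set (G → A)) : ℝ≥0∞ :=
  ⨆ (𝒰 : Finset (Set (G → A))) (_ : IsFiniteOpenCoverOn 𝒰 X), bowenEntropyCover Fseq 𝒰 X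

/-- The cylinder `[ω]_{F n} = {x ∈ A^G : x g = ω g for every g ∈ F n}`. -/
def cylinder (Fseq : ℕ → Finset G) (n : ℕ) (ω : G → A) : Set (G → A) :=
  {x : G → A | ∀ g ∈ Fseq n, x g = ω g}

end Defs

section Combinatorics

variable {G : Type*} [Group G] [DecidableEq G]

/-- The right translate `F a`. -/
def rightTranslate (F : Finset G) (a : G) : Finset G := F.image (fun f => f * a)

lemma mem_rightTranslate {F : Finset G} {a g : G} :
    g ∈ rightTranslate F a ↔ ∃ f ∈ F, f * a = g :=
  Finset.mem_image

lemma card_rightTranslate (F : Finset G) (a : G) : (rightTranslate F a).card = F.card :=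
  Finset.card_image_of_injective _ (mul_left_injective a)

/-- Greedy choice of `ε`-disjoint right translates of a single set. -/
lemma exists_almost_disjoint_translates (F : Finset G) {ε : ℝ} (h1 : ε ≤ 1)
    (B : Finset G) :
    ∃ S ⊆ B, (1 - ε) * (S.card * F.card) ≤ ((S.biUnion (rightTranslate F)).card : ℝ) ∧
      ∀ a ∈ B, ε * F.card ≤ ((rightTranslate F a ∩ S.biUnion (rightTranslate F)).card : ℝ) := by
  induction B using Finset.induction_on with
  | empty => exact ⟨∅, by simp, by simp, by simp⟩
  | insert a B ha ih =>
    obtain ⟨S, hSB, hS1, hS2⟩ := ih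
    set U := S.biUnion (rightTranslate F) with hU
    by_cases hc : ε * F.card ≤ ((rightTranslate F a ∩ U).card : ℝ)
    · refine ⟨S, hSB.trans (Finset.subset_insert _ _), hS1, ?_⟩
      intro b hb
      rcases Finset.mem_insert.1 hb with rfl | hb
      · exact hc
      · exact hS2 b hb
    · push Not at hc
      refine ⟨insert a S, Finset.insert_subset_insert _ hSB, ?_, ?_⟩
      · have haS : a ∉ S := fun h => ha (hSB h)
        rw [Finset.card_insert_of_notMem haS, Finset.biUnion_insert, ← hU]
        have h2 := Finset.card_union_add_card_inter (rightTranslate F a) U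
        rw [card_rightTranslate] at h2
        have h3 : ((rightTranslate F a ∪ U).card : ℝ) + (rightTranslate F a ∩ U).card
          = F.card + U.card := by exact_mod_cast h2
        push_cast
        nlinarith
      · intro b hb
        rw [Finset.biUnion_insert, ← hU]
        rcases Finset.mem_insert.1 hb with rfl | hb
        · rw [Finset.inter_eq_left.2 Finset.subset_union_left, card_rightTranslate]
          have : (0 : ℝ) ≤ F.card := by positivity
          nlinarith
        · refine (hS2 b hb).trans ?_
          exact_mod_cast Finset.card_le_card
            (Finset.inter_subset_inter_left Finset.subset_union_right)

lemma sum_card_translate_inter_le (F B U : Finset G) :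
    ∑ a ∈ B, (rightTranslate F a ∩ U).card ≤ U.card * F.card := by
  have h := Finset.sum_card_bipartiteAbove_eq_sum_card_bipartiteBelow
    (s := B) (t := U) (fun a u => u ∈ rightTranslate F a)
  have h1 : ∀ a ∈ B, (rightTranslate F a ∩ U).card =
      (Finset.bipartiteAbove (fun a u => u ∈ rightTranslate F a) U a).card := by
    intro a _
    congr 1
    ext u
    simp [Finset.mem_bipartiteAbove, and_comm]
  rw [Finset.sum_congr rfl h1, h, ← smul_eq_mul]
  refine Finset.sum_le_card_nsmul _ _ _ fun u _ => ?_
  refine Finset.card_le_card_of_injOn (fun a => u * a⁻¹) ?_ ?_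
  · intro a ha
    obtain ⟨f, hf, hfu⟩ := mem_rightTranslate.1
      ((Finset.mem_bipartiteBelow _).1 (Finset.mem_coe.1 ha)).2
    rw [← hfu]
    simpa using hf
  · intro a _ b _ hab
    simpa using hab

lemma exists_cover_single (F : Finset G) (hF : F.Nonempty) {ε : ℝ} (h1 : ε ≤ 1)
    (B : Finset G) :
    ∃ S ⊆ B, (1 - ε) * (S.card * F.card) ≤ ((S.biUnion (rightTranslate F)).card : ℝ) ∧
      ε * B.card ≤ ((S.biUnion (rightTranslate F)).card : ℝ) := by
  obtain ⟨S, hSB, hS1, hS2⟩ := exists_almost_disjoint_translates F h1 B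
  refine ⟨S, hSB, hS1, ?_⟩
  have h3 := sum_card_translate_inter_le F B (S.biUnion (rightTranslate F))
  have h4 : B.card * (ε * F.card) ≤
      ∑ a ∈ B, ((rightTranslate F a ∩ S.biUnion (rightTranslate F)).card : ℝ) := by
    rw [← nsmul_eq_mul]
    exact Finset.card_nsmul_le_sum _ _ _ hS2
  have h5 : ∑ a ∈ B, ((rightTranslate F a ∩ S.biUnion (rightTranslate F)).card : ℝ) ≤
      (S.biUnion (rightTranslate F)).card * F.card := by exact_mod_cast h3
  have hFpos : (0 : ℝ) < F.card := by exact_mod_cast hF.card_pos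
  refine le_of_mul_le_mul_right ?_ hFpos
  nlinarith

/-- A Vitali-type covering lemma along a tempered sequence: given a set `B` and a level `ν a` for
each `a ∈ B`, there is an `ε`-disjoint subfamily of `(F (ν a) a)` covering a set of size
comparable to `B`. -/
lemma exists_cover_of_tempered (F : ℕ → Finset G) (hF : ∀ n, (F n).Nonempty) {C : ℝ}
    (hC : ∀ n : ℕ, ((((Finset.range n).biUnion fun k => (F k)⁻¹ * F n)).card : ℝ) ≤
      C * ((F n).card : ℝ)) {ε : ℝ} (h0 : 0 < ε) (h1 : ε < 1) (hC0 : 0 ≤ C)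
    (ν : G → ℕ) (M : ℕ) (B : Finset G) (hB : ∀ a ∈ B, ν a < M) :
    ∃ S ⊆ B,
      (1 - ε) * ∑ a ∈ S, ((F (ν a)).card : ℝ) ≤
        ((S.biUnion fun a => rightTranslate (F (ν a)) a).card : ℝ) ∧
      (B.card : ℝ) ≤ (1 / ε + C / (1 - ε)) *
        ((S.biUnion fun a => rightTranslate (F (ν a)) a).card : ℝ) := by
  induction M generalizing B with
  | zero =>
    have : B = ∅ := Finset.eq_empty_of_forall_notMem fun a ha => by simpa using hB a ha
    subst this
    exact ⟨∅, by simp, by simp, by simp⟩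
  | succ M ih =>
    set B₁ := B.filter fun a => ν a = M with hB₁
    obtain ⟨S₁, hS₁, hS₁a, hS₁b⟩ := exists_cover_single (F M) (hF M) h1.le B₁
    set U₁ := S₁.biUnion (rightTranslate (F M)) with hU₁
    set B₂ := B.filter fun a => ν a < M ∧ Disjoint (rightTranslate (F (ν a)) a) U₁ with hB₂
    obtain ⟨S₂, hS₂, hS₂a, hS₂b⟩ := ih B₂ (fun a ha => (Finset.mem_filter.1 ha).2.1)
    set U₂ := S₂.biUnion fun a => rightTranslate (F (ν a)) a with hU₂
    have hν₁ : ∀ a ∈ S₁, ν a = M := fun a ha => (Finset.mem_filter.1 (hS₁ ha)).2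
    have hν₂ : ∀ a ∈ S₂, ν a < M := fun a ha => (Finset.mem_filter.1 (hS₂ ha)).2.1
    have hdS : Disjoint S₁ S₂ := Finset.disjoint_left.2 fun a ha hb =>
      (hν₂ a hb).ne (hν₁ a ha)
    have hU₁' : U₁ = S₁.biUnion fun a => rightTranslate (F (ν a)) a :=
      Finset.biUnion_congr rfl fun a ha => by rw [hν₁ a ha]
    have hdU : Disjoint U₁ U₂ := by
      rw [hU₂, Finset.disjoint_biUnion_right]
      intro a ha
      exact (Finset.mem_filter.1 (hS₂ ha)).2.2.symm
    have hUnion : (S₁ ∪ S₂).biUnion (fun a => rightTranslate (F (ν a)) a) = U₁ ∪ U₂ := by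
      rw [Finset.union_biUnion, ← hU₁']
    have hcard : ((U₁ ∪ U₂).card : ℝ) = U₁.card + U₂.card := by
      rw [Finset.card_union_of_disjoint hdU]; push_cast; rfl
    have hsum₁ : ∑ a ∈ S₁, ((F (ν a)).card : ℝ) = S₁.card * (F M).card := by
      rw [Finset.sum_congr rfl fun a ha => by rw [hν₁ a ha], Finset.sum_const, nsmul_eq_mul]
    refine ⟨S₁ ∪ S₂, Finset.union_subset (hS₁.trans (Finset.filter_subset _ _))
      (hS₂.trans (Finset.filter_subset _ _)), ?_, ?_⟩
    · rw [hUnion, hcard, Finset.sum_union hdS, hsum₁]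
      linarith
    · rw [hUnion, hcard]
      set W := (Finset.range M).biUnion fun k => (F k)⁻¹ * F M with hW
      have hsub : B ⊆ (B₁ ∪ B₂) ∪ S₁.biUnion (rightTranslate W) := by
        intro a ha
        have hlt := hB a ha
        by_cases hM : ν a = M
        · exact Finset.mem_union_left _ (Finset.mem_union_left _
            (Finset.mem_filter.2 ⟨ha, hM⟩))
        have hlt' : ν a < M := by omega
        by_cases hd : Disjoint (rightTranslate (F (ν a)) a) U₁
        · exact Finset.mem_union_left _ (Finset.mem_union_right _
            (Finset.mem_filter.2 ⟨ha, hlt', hd⟩))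
        · refine Finset.mem_union_right _ ?_
          obtain ⟨u, hu, hu'⟩ := Finset.not_disjoint_iff.1 hd
          obtain ⟨f, hf, rfl⟩ := mem_rightTranslate.1 hu
          obtain ⟨b, hb, hb'⟩ := Finset.mem_biUnion.1 hu'
          obtain ⟨f', hf', hff⟩ := mem_rightTranslate.1 hb'
          refine Finset.mem_biUnion.2 ⟨b, hb, mem_rightTranslate.2 ⟨f⁻¹ * f', ?_, ?_⟩⟩
          · exact Finset.mem_biUnion.2 ⟨ν a, Finset.mem_range.2 hlt',
              Finset.mul_mem_mul (Finset.inv_mem_inv hf) hf'⟩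
          · rw [mul_assoc, hff, inv_mul_cancel_left]
      have hle : (B.card : ℝ) ≤ B₁.card + B₂.card + S₁.card * W.card := by
        have h2 := (Finset.card_le_card hsub).trans (Finset.card_union_le _ _)
        have h3 := Finset.card_union_le B₁ B₂
        have h4 : (S₁.biUnion (rightTranslate W)).card ≤ S₁.card * W.card :=
          Finset.card_biUnion_le_card_mul _ _ _ fun a _ => (card_rightTranslate W a).le
        exact_mod_cast (by omega : B.card ≤ B₁.card + B₂.card + S₁.card * W.card)
      have h1ε : 0 < 1 - ε := by linarith
      have hB₁le : (B₁.card : ℝ) ≤ 1 / ε * U₁.card := by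
        rw [one_div, ← div_eq_inv_mul, le_div_iff₀ h0]; linarith
      have hWle : (S₁.card : ℝ) * W.card ≤ C / (1 - ε) * U₁.card := by
        have h5 : (S₁.card : ℝ) * (F M).card ≤ U₁.card / (1 - ε) := by
          rw [le_div_iff₀ h1ε]; linarith
        calc (S₁.card : ℝ) * W.card ≤ S₁.card * (C * (F M).card) := by
              gcongr; exact hC M
          _ = C * (S₁.card * (F M).card) := by ring
          _ ≤ C * (U₁.card / (1 - ε)) := by gcongr
          _ = _ := by ring
      linarith

/-- The points of `R` that some element of `K` moves out of `R`. -/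
def moveOut (K R : Finset G) : Finset G := R.filter fun a => ∃ f ∈ K, f * a ∉ R

lemma moveOut_subset (K R : Finset G) : moveOut K R ⊆ R := Finset.filter_subset _ _

lemma moveOut_mono {K K' : Finset G} (h : K ⊆ K') (R : Finset G) :
    moveOut K R ⊆ moveOut K' R :=
  Finset.monotone_filter_right _ fun _ _ ⟨f, hf, hf'⟩ => ⟨f, h hf, hf'⟩

/-- The points outside `R` that some element of `K` moves into `R`. -/
def moveIn (K R : Finset G) : Finset G := K.biUnion fun f => (R.image fun r => f⁻¹ * r) \ R

lemma mem_moveIn {K R : Finset G} {a : G} :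
    a ∈ moveIn K R ↔ a ∉ R ∧ ∃ f ∈ K, f * a ∈ R := by
  simp only [moveIn, Finset.mem_biUnion, Finset.mem_sdiff, Finset.mem_image]
  constructor
  · rintro ⟨f, hf, ⟨r, hr, rfl⟩, hR⟩
    exact ⟨hR, f, hf, by simpa using hr⟩
  · rintro ⟨hR, f, hf, hr⟩
    exact ⟨f, hf, ⟨_, hr, by simp⟩, hR⟩

lemma card_moveOut_sdiff_biUnion_le (K R : Finset G) (S : Finset G) (E : G → Finset G) :
    (moveOut K (R \ S.biUnion fun a => rightTranslate (E a) a)).card ≤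
      (moveOut K R).card + ∑ a ∈ S, (moveIn K (E a)).card := by
  have hsub : moveOut K (R \ S.biUnion fun a => rightTranslate (E a) a) ⊆
      moveOut K R ∪ S.biUnion fun a => rightTranslate (moveIn K (E a)) a := by
    intro g hg
    obtain ⟨hgR, f, hf, hfg⟩ := Finset.mem_filter.1 hg
    obtain ⟨hgR, hgU⟩ := Finset.mem_sdiff.1 hgR
    by_cases hR : f * g ∈ R
    · refine Finset.mem_union_right _ ?_
      have hfU : f * g ∈ S.biUnion fun a => rightTranslate (E a) a := by
        by_contra h
        exact hfg (Finset.mem_sdiff.2 ⟨hR, h⟩)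
      obtain ⟨a, ha, hga⟩ := Finset.mem_biUnion.1 hfU
      obtain ⟨e, he, hea⟩ := mem_rightTranslate.1 hga
      refine Finset.mem_biUnion.2 ⟨a, ha, mem_rightTranslate.2 ⟨g * a⁻¹, ?_, by simp⟩⟩
      refine mem_moveIn.2 ⟨fun h => hgU (Finset.mem_biUnion.2
        ⟨a, ha, mem_rightTranslate.2 ⟨_, h, by simp⟩⟩), f, hf, ?_⟩
      rw [← mul_assoc, ← hea]
      simpa using he
    · exact Finset.mem_union_left _ (Finset.mem_filter.2 ⟨hgR, f, hf, hR⟩)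
  refine (Finset.card_le_card hsub).trans ((Finset.card_union_le _ _).trans ?_)
  gcongr
  refine Finset.card_biUnion_le.trans (Finset.sum_le_sum fun a _ => ?_)
  rw [card_rightTranslate]

lemma IsFolnerSeq.eventually_card_moveIn_le {F : ℕ → Finset G} (hF : IsFolnerSeq F)
    (K : Finset G) {η : ℝ} (hη : 0 < η) :
    ∀ᶠ n in atTop, ((moveIn K (F n)).card : ℝ) ≤ η * (F n).card := by
  have h : Tendsto (fun n => ∑ f ∈ K, ((symmDiff (F n) ((F n).image (fun h => f⁻¹ * h))).card : ℝ)
      / ((F n).card : ℝ)) atTop (𝓝 0) := by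
    simpa using tendsto_finsetSum K fun f _ => hF.2 f⁻¹
  filter_upwards [h.eventually (gt_mem_nhds hη)] with n hn
  have hpos : (0 : ℝ) < (F n).card := by exact_mod_cast (hF.1 n).card_pos
  rw [← Finset.sum_div, div_lt_iff₀ hpos] at hn
  refine le_trans ?_ hn.le
  have h2 : (moveIn K (F n)).card ≤
      ∑ f ∈ K, (symmDiff (F n) ((F n).image (fun h => f⁻¹ * h))).card := by
    refine Finset.card_biUnion_le.trans (Finset.sum_le_sum fun f _ => Finset.card_le_card ?_)
    intro g hg
    rw [Finset.mem_symmDiff]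
    exact Or.inr (Finset.mem_sdiff.1 hg)
  exact_mod_cast h2

lemma IsFolnerSeq.eventually_card_moveOut_le {F : ℕ → Finset G} (hF : IsFolnerSeq F)
    (K : Finset G) {η : ℝ} (hη : 0 < η) :
    ∀ᶠ n in atTop, ((moveOut K (F n)).card : ℝ) ≤ η * (F n).card := by
  have h : Tendsto (fun n => ∑ f ∈ K, ((symmDiff (F n) ((F n).image (fun h => f⁻¹ * h))).card : ℝ)
      / ((F n).card : ℝ)) atTop (𝓝 0) := by
    simpa using tendsto_finsetSum K fun f _ => hF.2 f⁻¹
  filter_upwards [h.eventually (gt_mem_nhds hη)] with n hn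
  have hpos : (0 : ℝ) < (F n).card := by exact_mod_cast (hF.1 n).card_pos
  rw [← Finset.sum_div, div_lt_iff₀ hpos] at hn
  refine le_trans ?_ hn.le
  have hsub : moveOut K (F n) ⊆ K.biUnion fun f =>
      symmDiff (F n) ((F n).image (fun h => f⁻¹ * h)) := by
    intro g hg
    obtain ⟨hgR, f, hf, hfg⟩ := Finset.mem_filter.1 hg
    refine Finset.mem_biUnion.2 ⟨f, hf, Finset.mem_symmDiff.2 (Or.inl ⟨hgR, fun h => hfg ?_⟩)⟩
    obtain ⟨r, hr, rfl⟩ := Finset.mem_image.1 h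
    simpa using hr
  exact_mod_cast (Finset.card_le_card hsub).trans Finset.card_biUnion_le

end Combinatorics

section Counting

variable {G : Type*} [Group G] [DecidableEq G] {A : Type*}

/-- The region covered by a family `T` of translated words. -/
def coveredBy (F : ℕ → Finset G) (T : Finset (G × (ℕ × (G → A)))) : Finset G :=
  T.biUnion fun t => rightTranslate (F t.2.1) t.1

/-- `T` is an `ε`-disjoint family of occurrences inside `R` of words from `Λ` in `x`. -/
structure IsOccurrenceFamily (F : ℕ → Finset G) (ε : ℝ) (Λ : Finset (ℕ × (G → A)))
    (R : Finset G) (x : G → A) (T : Finset (G × (ℕ × (G → A)))) : Prop where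
  subset : T ⊆ R ×ˢ Λ
  covered_subset : coveredBy F T ⊆ R
  occurs : ∀ t ∈ T, ∀ f ∈ F t.2.1, x (f * t.1) = t.2.2 f
  packing : (1 - ε) * ∑ t ∈ T, ((F t.2.1).card : ℝ) ≤ ((coveredBy F T).card : ℝ)

/-- `X` has covers by cylinders of arbitrarily deep level with arbitrarily small weight `s`. -/
def HasSmallCovers (F : ℕ → Finset G) (X : Set (G → A)) (s : ℝ) : Prop :=
  ∀ θ : ℝ, 0 < θ → ∀ N : ℕ, ∃ Λ : Finset (ℕ × (G → A)), (∀ p ∈ Λ, N ≤ p.1) ∧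
    (X ⊆ ⋃ p ∈ Λ, cylinder F p.1 p.2) ∧
    ∑ p ∈ Λ, Real.exp (-s * ((F p.1).card : ℝ)) ≤ θ

lemma IsOccurrenceFamily.union {F : ℕ → Finset G} {ε : ℝ} {Λ₁ Λ₂ : Finset (ℕ × (G → A))}
    {R : Finset G} {x : G → A} {T₁ T₂ : Finset (G × (ℕ × (G → A)))} (hε : ε < 1)
    (h₁ : IsOccurrenceFamily F ε Λ₁ R x T₁)
    (h₂ : IsOccurrenceFamily F ε Λ₂ (R \ coveredBy F T₁) x T₂) :
    IsOccurrenceFamily F ε (Λ₁ ∪ Λ₂) R x (T₁ ∪ T₂) := by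
  have hU : coveredBy F (T₁ ∪ T₂) = coveredBy F T₁ ∪ coveredBy F T₂ :=
    Finset.union_biUnion
  have hd : Disjoint (coveredBy F T₁) (coveredBy F T₂) :=
    Finset.disjoint_of_subset_right h₂.covered_subset Finset.disjoint_sdiff
  refine ⟨?_, ?_, ?_, ?_⟩
  · refine Finset.union_subset (h₁.subset.trans ?_) (h₂.subset.trans ?_)
    · exact Finset.product_subset_product le_rfl Finset.subset_union_left
    · exact Finset.product_subset_product Finset.sdiff_subset Finset.subset_union_right
  · rw [hU]
    exact Finset.union_subset h₁.covered_subset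
      (h₂.covered_subset.trans Finset.sdiff_subset)
  · intro t ht
    rcases Finset.mem_union.1 ht with ht | ht
    · exact h₁.occurs t ht
    · exact h₂.occurs t ht
  · rw [hU, Finset.card_union_of_disjoint hd]
    have h3 : ∑ t ∈ T₁ ∪ T₂, ((F t.2.1).card : ℝ) ≤
        ∑ t ∈ T₁, ((F t.2.1).card : ℝ) + ∑ t ∈ T₂, ((F t.2.1).card : ℝ) := by
      rw [← Finset.sum_union_inter]
      exact le_add_of_nonneg_right (Finset.sum_nonneg fun _ _ => by positivity)
    have h4 := mul_le_mul_of_nonneg_left h3 (by linarith : 0 ≤ 1 - ε)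
    push_cast
    linarith [h₁.packing, h₂.packing]

lemma exists_occurrenceFamily_single {F : ℕ → Finset G} (hF : ∀ n, (F n).Nonempty) {C : ℝ}
    (hC0 : 0 ≤ C)
    (hC : ∀ n : ℕ, ((((Finset.range n).biUnion fun k => (F k)⁻¹ * F n)).card : ℝ) ≤
      C * ((F n).card : ℝ)) {ε : ℝ} (h0 : 0 < ε) (h1 : ε < 1)
    {X : Set (G → A)} (hX : ∀ g : G, ∀ x ∈ X, shift g x ∈ X)
    {Λ : Finset (ℕ × (G → A))} (hΛ : X ⊆ ⋃ p ∈ Λ, cylinder F p.1 p.2)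
    {K : Finset G} (hK : ∀ p ∈ Λ, F p.1 ⊆ K) {K₀ : Finset G} {η : ℝ}
    (hη : ∀ p ∈ Λ, ((moveIn K₀ (F p.1)).card : ℝ) ≤ η * (F p.1).card)
    (R : Finset G) {x : G → A} (hx : x ∈ X) :
    ∃ T, IsOccurrenceFamily F ε Λ R x T ∧
      ((R.card : ℝ) - (moveOut K R).card ≤
        (1 / ε + C / (1 - ε)) * (coveredBy F T).card) ∧
      ((moveOut K₀ (R \ coveredBy F T)).card : ℝ) ≤ (moveOut K₀ R).card +
        η * ∑ t ∈ T, ((F t.2.1).card : ℝ) := by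
  have hocc : ∀ a : G, ∃ p ∈ Λ, ∀ f ∈ F p.1, x (f * a) = p.2 f := by
    intro a
    simpa [cylinder, shift] using hΛ (hX a x hx)
  choose p hpΛ hp using hocc
  have hB : ∀ a ∈ R \ moveOut K R, (p a).1 < Λ.sup (fun q => q.1) + 1 := fun a _ =>
    Nat.lt_succ_of_le (Finset.le_sup (f := fun q : ℕ × (G → A) => q.1) (hpΛ a))
  obtain ⟨S, hSB, hS1, hS2⟩ :=
    exists_cover_of_tempered F hF hC h0 h1 hC0 (fun a => (p a).1) _ _ hB
  have hinj : Function.Injective fun a => (a, p a) := fun a b h => (Prod.ext_iff.1 h).1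
  have hcov : coveredBy F (S.image fun a => (a, p a)) =
      S.biUnion fun a => rightTranslate (F (p a).1) a := by
    rw [coveredBy, Finset.image_biUnion]
  have hsum : ∑ t ∈ S.image (fun a => (a, p a)), ((F t.2.1).card : ℝ) =
      ∑ a ∈ S, ((F (p a).1).card : ℝ) := Finset.sum_image hinj.injOn
  have hSR : S ⊆ R := hSB.trans Finset.sdiff_subset
  refine ⟨S.image fun a => (a, p a), ⟨?_, ?_, ?_, ?_⟩, ?_, ?_⟩
  · intro t ht
    obtain ⟨a, ha, rfl⟩ := Finset.mem_image.1 ht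
    exact Finset.mem_product.2 ⟨hSR ha, hpΛ a⟩
  · rw [hcov]
    refine Finset.biUnion_subset.2 fun a ha g hg => ?_
    obtain ⟨f, hf, rfl⟩ := mem_rightTranslate.1 hg
    by_contra hfa
    exact (Finset.mem_sdiff.1 (hSB ha)).2
      (Finset.mem_filter.2 ⟨hSR ha, f, hK _ (hpΛ a) hf, hfa⟩)
  · intro t ht
    obtain ⟨a, ha, rfl⟩ := Finset.mem_image.1 ht
    exact hp a
  · rw [hcov, hsum]
    exact hS1
  · rw [hcov]
    refine le_trans (le_of_eq ?_) hS2
    rw [Finset.card_sdiff_of_subset (moveOut_subset K R),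
      Nat.cast_sub (Finset.card_le_card (moveOut_subset K R))]
  · rw [hcov, hsum, Finset.mul_sum]
    have h := card_moveOut_sdiff_biUnion_le K₀ R S fun a => F (p a).1
    have h' : ((moveOut K₀ (R \ S.biUnion fun a => rightTranslate (F (p a).1) a)).card : ℝ) ≤
        (moveOut K₀ R).card + ∑ a ∈ S, ((moveIn K₀ (F (p a).1)).card : ℝ) := by
      exact_mod_cast h
    refine h'.trans ?_
    gcongr with a _
    exact hη _ (hpΛ a)

/-- Iterating the covering over `k` scales leaves a fraction of about `(1 - γ) ^ k` uncovered. -/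
lemma exists_occurrenceFamily {F : ℕ → Finset G} (hF : IsFolnerSeq F) {C : ℝ}
    (hC0 : 0 ≤ C)
    (hC : ∀ n : ℕ, ((((Finset.range n).biUnion fun k => (F k)⁻¹ * F n)).card : ℝ) ≤
      C * ((F n).card : ℝ)) {ε : ℝ} (h0 : 0 < ε) (h1 : ε < 1)
    {X : Set (G → A)} (hX : ∀ g : G, ∀ x ∈ X, shift g x ∈ X) {s : ℝ}
    (hs : HasSmallCovers F X s) {γ : ℝ} (hγ0 : 0 ≤ γ) (hγ1 : γ ≤ 1)
    (hγ : γ * (1 / ε + C / (1 - ε)) ≤ 1) (k : ℕ) {θ : ℝ} (hθ : 0 < θ) :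
    ∃ (Λ : Finset (ℕ × (G → A))) (K : Finset G),
      ∑ p ∈ Λ, Real.exp (-s * ((F p.1).card : ℝ)) ≤ θ ∧
      ∀ R : Finset G, ∀ x ∈ X, ∃ T, IsOccurrenceFamily F ε Λ R x T ∧
        ((R \ coveredBy F T).card : ℝ) ≤
          (1 - γ) ^ k * R.card + k * (moveOut K R).card + θ * R.card := by
  induction k generalizing θ with
  | zero =>
    refine ⟨∅, ∅, by simpa using hθ.le, fun R x _ => ⟨∅, ⟨?_, ?_, ?_, ?_⟩, ?_⟩⟩
    · simp
    · simp [coveredBy]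
    · simp
    · simp
    · simp [coveredBy]; positivity
  | succ k ih =>
    obtain ⟨Λ₀, K₀, hΛ₀, hcov₀⟩ := ih (half_pos hθ)
    have h1ε : 0 < 1 - ε := by linarith
    set η : ℝ := (1 - ε) * (θ / 2) / (k + 1) with hη
    have hηpos : 0 < η := by positivity
    obtain ⟨N, hN⟩ := eventually_atTop.1 (hF.eventually_card_moveIn_le K₀ hηpos)
    obtain ⟨Λ₁, hΛ₁N, hΛ₁X, hΛ₁⟩ := hs (θ / 2) (half_pos hθ) N
    set K := K₀ ∪ Λ₁.biUnion (fun p => F p.1) with hK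
    refine ⟨Λ₁ ∪ Λ₀, K, ?_, fun R x hx => ?_⟩
    · have h3 : ∑ p ∈ Λ₁ ∪ Λ₀, Real.exp (-s * ((F p.1).card : ℝ)) ≤
          ∑ p ∈ Λ₁, Real.exp (-s * ((F p.1).card : ℝ)) +
          ∑ p ∈ Λ₀, Real.exp (-s * ((F p.1).card : ℝ)) := by
        rw [← Finset.sum_union_inter]
        exact le_add_of_nonneg_right (Finset.sum_nonneg fun _ _ => by positivity)
      linarith
    · have hKsub : ∀ p ∈ Λ₁, F p.1 ⊆ K := fun p hp =>
        (Finset.subset_biUnion_of_mem (fun p : ℕ × (G → A) => F p.1) hp).trans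
          Finset.subset_union_right
      obtain ⟨T₁, hT₁, hT₁a, hT₁b⟩ := exists_occurrenceFamily_single hF.1 hC0 hC h0 h1 hX hΛ₁X
        hKsub (fun p hp => hN _ (hΛ₁N p hp)) R hx
      obtain ⟨T₀, hT₀, hT₀a⟩ := hcov₀ (R \ coveredBy F T₁) x hx
      refine ⟨T₁ ∪ T₀, hT₁.union h1 hT₀, ?_⟩
      have hU : R \ coveredBy F (T₁ ∪ T₀) = (R \ coveredBy F T₁) \ coveredBy F T₀ := by
        rw [coveredBy, Finset.union_biUnion, Finset.sdiff_union_distrib,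
          Finset.sdiff_sdiff_left']
        rfl
      rw [hU]
      refine hT₀a.trans ?_
      have hcardR : ((R \ coveredBy F T₁).card : ℝ) = R.card - (coveredBy F T₁).card := by
        rw [Finset.card_sdiff_of_subset hT₁.covered_subset,
          Nat.cast_sub (Finset.card_le_card hT₁.covered_subset)]
      have hUR : ((coveredBy F T₁).card : ℝ) ≤ R.card := by
        exact_mod_cast Finset.card_le_card hT₁.covered_subset
      have hb : ((moveOut K₀ R).card : ℝ) ≤ (moveOut K R).card := by
        exact_mod_cast Finset.card_le_card (moveOut_mono Finset.subset_union_left R)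
      have hR0 : (0 : ℝ) ≤ R.card := by positivity
      have hm0 : (0 : ℝ) ≤ (moveOut K R).card := by positivity
      have hU0 : (0 : ℝ) ≤ (coveredBy F T₁).card := by positivity
      have hrem : ((R \ coveredBy F T₁).card : ℝ) ≤
          (1 - γ) * R.card + (moveOut K R).card := by
        have h5 := mul_le_mul_of_nonneg_left hT₁a hγ0
        have h6 := mul_le_mul_of_nonneg_right hγ hU0
        nlinarith
      have hout : (k : ℝ) * (moveOut K₀ (R \ coveredBy F T₁)).card ≤
          k * (moveOut K R).card + θ / 2 * R.card := by
        have h7 : η * ∑ t ∈ T₁, ((F t.2.1).card : ℝ) ≤ (θ / 2) / (k + 1) * R.card := by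
          calc η * ∑ t ∈ T₁, ((F t.2.1).card : ℝ)
              = (θ / 2) / (k + 1) * ((1 - ε) * ∑ t ∈ T₁, ((F t.2.1).card : ℝ)) := by
                rw [hη]; ring
            _ ≤ (θ / 2) / (k + 1) * R.card := by
                gcongr; exact hT₁.packing.trans hUR
        have h8 : (k : ℝ) * ((θ / 2) / (k + 1) * R.card) ≤ θ / 2 * R.card := by
          have : (k : ℝ) * ((θ / 2) / (k + 1)) ≤ θ / 2 := by
            rw [mul_div_assoc', div_le_iff₀ (by positivity)]
            nlinarith
          nlinarith
        have hk : (0 : ℝ) ≤ k := by positivity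
        nlinarith
      have hpow : (1 - γ) ^ k * ((R \ coveredBy F T₁).card : ℝ) ≤
          (1 - γ) ^ (k + 1) * R.card + (moveOut K R).card := by
        have hp0 : 0 ≤ (1 - γ) ^ k := pow_nonneg (by linarith) k
        have hp1 : (1 - γ) ^ k ≤ 1 := pow_le_one₀ (by linarith) (by linarith)
        have := mul_le_mul_of_nonneg_left hrem hp0
        rw [pow_succ]
        nlinarith
      have hlast : θ / 2 * ((R \ coveredBy F T₁).card : ℝ) ≤ θ / 2 * R.card := by
        gcongr
        exact Finset.sdiff_subset
      push_cast
      linarith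

/-- The set of patterns of `X` on `D`. -/
def patterns (X : Set (G → A)) (D : Finset G) : Set (D → A) :=
  (fun x (g : D) => x g) '' X

lemma sum_prod_powerset_le {ι : Type*} (P : Finset ι) {w : ι → ℝ} (hw : ∀ i, 0 ≤ w i) :
    ∑ T ∈ P.powerset, ∏ i ∈ T, w i ≤ Real.exp (∑ i ∈ P, w i) := by
  rw [← Finset.prod_one_add, Real.exp_sum]
  refine Finset.prod_le_prod (fun i _ => by linarith [hw i]) fun i _ => ?_
  linarith [Real.add_one_le_exp (w i)]

lemma ncard_patterns_le [Fintype A] {F : ℕ → Finset G} {ε s δ θ : ℝ} (h1 : ε < 1)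
    (hs : 0 ≤ s) {Λ : Finset (ℕ × (G → A))}
    (hΛ : ∑ p ∈ Λ, Real.exp (-s * ((F p.1).card : ℝ)) ≤ θ)
    {X : Set (G → A)} (R : Finset G)
    (h : ∀ x ∈ X, ∃ T, IsOccurrenceFamily F ε Λ R x T ∧
      ((R \ coveredBy F T).card : ℝ) ≤ δ * R.card) :
    ((patterns X R).ncard : ℝ) ≤
      Real.exp ((s / (1 - ε) + θ + δ * Real.log (Fintype.card A)) * R.card) := by
  rcases X.eq_empty_or_nonempty with rfl | ⟨x₀, hx₀⟩
  · simp [patterns]; positivity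
  by_cases hR : R = ∅
  · subst hR
    have : (patterns X (∅ : Finset G)).ncard ≤ 1 := Set.ncard_le_one_of_subsingleton _
    simpa using this
  obtain ⟨g₀, hg₀⟩ := Finset.nonempty_iff_ne_empty.2 hR
  have hA : 1 ≤ Fintype.card A := Fintype.card_pos_iff.2 ⟨x₀ g₀⟩
  have h1ε : 0 < 1 - ε := by linarith
  set D : ℝ := (R.card : ℝ) with hD
  have hD0 : 0 ≤ D := by positivity
  choose! T hT hTδ using h
  set 𝒯 := ((R ×ˢ Λ).powerset).filter fun T =>
    (∑ t ∈ T, ((F t.2.1).card : ℝ) ≤ D / (1 - ε)) ∧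
      ((R \ coveredBy F T).card : ℝ) ≤ δ * D with h𝒯
  have hT𝒯 : ∀ x ∈ X, T x ∈ 𝒯 := by
    intro x hx
    refine Finset.mem_filter.2 ⟨Finset.mem_powerset.2 (hT x hx).subset, ?_, hTδ x hx⟩
    rw [le_div_iff₀ h1ε, mul_comm]
    refine (hT x hx).packing.trans ?_
    rw [hD]
    exact_mod_cast Finset.card_le_card (hT x hx).covered_subset
  let Q : Finset (G × (ℕ × (G → A))) → Set (R → A) := fun T' =>
    (fun x (g : R) => x g) '' {x | x ∈ X ∧ T x = T'}
  have hQ : patterns X R ⊆ ⋃ T' ∈ 𝒯, Q T' := by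
    rintro _ ⟨x, hx, rfl⟩
    exact Set.mem_biUnion (hT𝒯 x hx) ⟨x, ⟨hx, rfl⟩, rfl⟩
  have hQcard : ∀ T' ∈ 𝒯, ((Q T').ncard : ℝ) ≤ Real.exp (δ * Real.log (Fintype.card A) * D) := by
    intro T' hT'
    have hinj : Set.InjOn (fun (y : R → A) (g : (R \ coveredBy F T' : Finset G)) =>
        y ⟨g, (Finset.mem_sdiff.1 g.2).1⟩) (Q T') := by
      rintro _ ⟨x, ⟨hx, hxT⟩, rfl⟩ _ ⟨y, ⟨hy, hyT⟩, rfl⟩ hxy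
      funext g
      by_cases hg : (g : G) ∈ coveredBy F T'
      · obtain ⟨t, ht, hgt⟩ := Finset.mem_biUnion.1 hg
        obtain ⟨f, hf, hfg⟩ := mem_rightTranslate.1 hgt
        have e1 := (hT x hx).occurs t (hxT ▸ ht) f hf
        have e2 := (hT y hy).occurs t (hyT ▸ ht) f hf
        simp only [← hfg, e1, e2]
      · exact congrFun hxy ⟨g, Finset.mem_sdiff.2 ⟨g.2, hg⟩⟩
    have h2 := (Set.ncard_le_ncard_of_injOn _ (fun _ _ => Set.mem_univ _) hinj
      Set.finite_univ)
    rw [Set.ncard_univ, Nat.card_eq_fintype_card, Fintype.card_fun, Fintype.card_coe] at h2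
    have h3 := (Finset.mem_filter.1 hT').2.2
    have hlog : 0 ≤ Real.log (Fintype.card A) := Real.log_nonneg (by exact_mod_cast hA)
    calc ((Q T').ncard : ℝ) ≤ (Fintype.card A : ℝ) ^ (R \ coveredBy F T').card := by
          exact_mod_cast h2
      _ = Real.exp (Real.log (Fintype.card A) * (R \ coveredBy F T').card) := by
          rw [mul_comm, Real.exp_nat_mul, Real.exp_log (by exact_mod_cast hA)]
      _ ≤ _ := by
          rw [Real.exp_le_exp]
          calc Real.log (Fintype.card A) * ((R \ coveredBy F T').card : ℝ)
              ≤ Real.log (Fintype.card A) * (δ * D) := by gcongr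
            _ = _ := by ring
  have h𝒯card : (𝒯.card : ℝ) ≤ Real.exp ((s / (1 - ε) + θ) * D) := by
    have h4 : (𝒯.card : ℝ) * Real.exp (-(s / (1 - ε) * D)) ≤
        ∑ T ∈ 𝒯, ∏ t ∈ T, Real.exp (-s * ((F t.2.1).card : ℝ)) := by
      rw [← nsmul_eq_mul]
      refine Finset.card_nsmul_le_sum _ _ _ fun T' hT' => ?_
      rw [← Real.exp_sum, Real.exp_le_exp, ← Finset.mul_sum]
      have h5 := mul_le_mul_of_nonneg_left (Finset.mem_filter.1 hT').2.1 hs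
      calc -(s / (1 - ε) * D) = -(s * (D / (1 - ε))) := by ring
        _ ≤ -(s * ∑ t ∈ T', ((F t.2.1).card : ℝ)) := neg_le_neg h5
        _ = _ := by ring
    have h5 : ∑ T ∈ 𝒯, ∏ t ∈ T, Real.exp (-s * ((F t.2.1).card : ℝ)) ≤
        ∑ T ∈ (R ×ˢ Λ).powerset, ∏ t ∈ T, Real.exp (-s * ((F t.2.1).card : ℝ)) :=
      Finset.sum_le_sum_of_subset_of_nonneg (Finset.filter_subset _ _)
        fun _ _ _ => by positivity
    have h6 := sum_prod_powerset_le (R ×ˢ Λ)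
      (w := fun t => Real.exp (-s * ((F t.2.1).card : ℝ))) fun _ => by positivity
    have h7 : ∑ t ∈ R ×ˢ Λ, Real.exp (-s * ((F t.2.1).card : ℝ)) ≤ D * θ := by
      rw [Finset.sum_product, hD, ← nsmul_eq_mul]
      exact Finset.sum_le_card_nsmul _ _ _ fun _ _ => hΛ
    have h8 := h4.trans (h5.trans (h6.trans (Real.exp_le_exp.2 h7)))
    rw [Real.exp_neg, ← div_eq_mul_inv, div_le_iff₀ (Real.exp_pos _), ← Real.exp_add] at h8
    refine h8.trans (le_of_eq ?_)
    congr 1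
    ring
  have h9 : (patterns X R).ncard ≤ ∑ T' ∈ 𝒯, (Q T').ncard :=
    (Set.ncard_le_ncard hQ (Set.toFinite _)).trans (Finset.set_ncard_biUnion_le _ _)
  calc ((patterns X R).ncard : ℝ) ≤ ∑ T' ∈ 𝒯, ((Q T').ncard : ℝ) := by exact_mod_cast h9
    _ ≤ 𝒯.card * Real.exp (δ * Real.log (Fintype.card A) * D) := by
        rw [← nsmul_eq_mul]
        exact Finset.sum_le_card_nsmul _ _ _ hQcard
    _ ≤ Real.exp ((s / (1 - ε) + θ) * D) * Real.exp (δ * Real.log (Fintype.card A) * D) := by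
        gcongr
    _ = _ := by
        rw [← Real.exp_add]; congr 1; ring

end Counting

section Entropy

lemma ncard_patterns_le_mul {G A : Type*} [DecidableEq G] [Fintype A] (X : Set (G → A)) (D D' : Finset G) :
    (patterns X D').ncard ≤ (patterns X D).ncard * Fintype.card A ^ (D' \ D).card := by
  have hinj : Set.InjOn (fun (y : D' → A) =>
      ((fun g : D => if h : (g : G) ∈ D' then some (y ⟨g, h⟩) else none),
        fun g : (D' \ D : Finset G) => y ⟨g, (Finset.mem_sdiff.1 g.2).1⟩))
      (patterns X D') := by
    intro x _ y _ hxy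
    obtain ⟨h1, h2⟩ := Prod.ext_iff.1 hxy
    funext g
    by_cases hg : (g : G) ∈ D
    · simpa using congrFun h1 ⟨g, hg⟩
    · exact congrFun h2 ⟨g, Finset.mem_sdiff.2 ⟨g.2, hg⟩⟩
  have hmaps : Set.MapsTo (fun (y : D' → A) =>
      ((fun g : D => if h : (g : G) ∈ D' then some (y ⟨g, h⟩) else none),
        fun g : (D' \ D : Finset G) => y ⟨g, (Finset.mem_sdiff.1 g.2).1⟩))
      (patterns X D') (((fun (p : D → A) (g : D) =>
        if (g : G) ∈ D' then some (p g) else none) '' patterns X D) ×ˢ Set.univ) := by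
    rintro _ ⟨x, hx, rfl⟩
    refine ⟨⟨_, ⟨x, hx, rfl⟩, ?_⟩, Set.mem_univ _⟩
    funext g
    by_cases h : (g : G) ∈ D' <;> simp [h]
  have h := Set.ncard_le_ncard_of_injOn _ hmaps hinj (Set.toFinite _)
  rw [Set.ncard_prod, Set.ncard_univ, Nat.card_eq_fintype_card, Fintype.card_fun,
    Fintype.card_coe] at h
  refine h.trans ?_
  gcongr
  exact Set.ncard_image_le (Set.toFinite _)

variable {G : Type*} [Group G] [DecidableEq G] {A : Type*}

lemma eventually_ncard_patterns_le [Fintype A] {F : ℕ → Finset G} (hF : IsFolnerSeq F)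
    (hT : IsTemperedSeq F) {X : Set (G → A)} (hX : ∀ g : G, ∀ x ∈ X, shift g x ∈ X) {s t : ℝ}
    (hs0 : 0 ≤ s) (hst : s < t) (hs : HasSmallCovers F X s) :
    ∀ᶠ n in atTop, ((patterns X (F n)).ncard : ℝ) ≤ Real.exp (t * (F n).card) := by
  obtain ⟨C, hC0, hC⟩ := hT
  set κ := (t - s) / 3 with hκ
  have hκ0 : 0 < κ := by rw [hκ]; linarith
  have hlog : 0 ≤ Real.log (Fintype.card A) := Real.log_natCast_nonneg _
  set ε := κ / (s + κ + 1) with hε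
  have hε0 : 0 < ε := by positivity
  have hε1 : ε < 1 := by rw [hε, div_lt_one (by positivity)]; linarith
  have h1ε : 0 < 1 - ε := by linarith
  have hsε : s / (1 - ε) ≤ s + κ := by
    rw [div_le_iff₀ h1ε]
    have : ε * (s + κ + 1) = κ := div_mul_cancel₀ _ (by positivity)
    nlinarith
  set δ := κ / (Real.log (Fintype.card A) + 1) with hδ
  have hδ0 : 0 < δ := by positivity
  have hδlog : δ * Real.log (Fintype.card A) ≤ κ := by
    have : δ * (Real.log (Fintype.card A) + 1) = κ := div_mul_cancel₀ _ (by positivity)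
    nlinarith
  set Γ := 1 / ε + C / (1 - ε) with hΓ
  have hΓ1 : 1 ≤ Γ := by
    have h1 : 1 ≤ 1 / ε := by rw [le_div_iff₀ hε0]; linarith
    have h2 : 0 ≤ C / (1 - ε) := by positivity
    linarith
  have hγ0 : 0 < Γ⁻¹ := by positivity
  have hγ1 : Γ⁻¹ ≤ 1 := inv_le_one_of_one_le₀ hΓ1
  obtain ⟨k, hk⟩ := exists_pow_lt_of_lt_one (show 0 < δ / 3 by positivity)
    (show 1 - Γ⁻¹ < 1 by linarith)
  have hθ : 0 < min κ (δ / 3) := lt_min hκ0 (by positivity)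
  obtain ⟨Λ, K, hΛ, hcov⟩ := exists_occurrenceFamily hF hC0.le hC hε0 hε1 hX hs hγ0.le hγ1
    (inv_mul_cancel₀ (by positivity)).le k hθ
  filter_upwards [hF.eventually_card_moveOut_le K
    (show 0 < δ / 3 / (k + 1) by positivity)] with n hn
  refine (ncard_patterns_le (δ := δ) hε1 hs0 (hΛ.trans (min_le_left _ _)) (F n)
    fun x hx => ?_).trans ?_
  · obtain ⟨T, hT, hTc⟩ := hcov (F n) x hx
    refine ⟨T, hT, hTc.trans ?_⟩
    have hc : (0 : ℝ) ≤ (F n).card := by positivity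
    have h1 : (1 - Γ⁻¹) ^ k * ((F n).card : ℝ) ≤ δ / 3 * (F n).card := by gcongr
    have h2 : min κ (δ / 3) * ((F n).card : ℝ) ≤ δ / 3 * (F n).card := by
      gcongr; exact min_le_right _ _
    have h3 : (k : ℝ) * (moveOut K (F n)).card ≤ δ / 3 * (F n).card := by
      calc (k : ℝ) * (moveOut K (F n)).card ≤ (k + 1) * (δ / 3 / (k + 1) * (F n).card) := by
            gcongr; linarith
        _ = _ := by field_simp
    linarith
  · rw [Real.exp_le_exp]
    gcongr
    rw [hκ] at *
    linarith

lemma exists_finset_lebesgue [TopologicalSpace A] [DiscreteTopology A] {X : Set (G → A)}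
    (hX : IsCompact X) {𝒰 : Finset (Set (G → A))} (h𝒰 : IsFiniteOpenCoverOn 𝒰 X) :
    ∃ K : Finset G, ∀ x ∈ X, ∃ U ∈ 𝒰, ∀ y : G → A, (∀ g ∈ K, y g = x g) → y ∈ U := by
  have h1 : ∀ x ∈ X, ∃ K : Finset G, ∃ U ∈ 𝒰, ∀ y : G → A, (∀ g ∈ K, y g = x g) → y ∈ U := by
    intro x hx
    obtain ⟨U, hU, hxU⟩ := h𝒰.2 hx
    obtain ⟨K, u, hu, hKu⟩ := isOpen_pi_iff.1 (h𝒰.1 U hU) x hxU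
    refine ⟨K, U, hU, fun y hy => hKu fun g hg => ?_⟩
    rw [hy g hg]
    exact (hu g hg).2
  choose! K hK using h1
  obtain ⟨t, htX, ht⟩ := hX.elim_nhds_subcover (fun x => {y | ∀ g ∈ K x, y g = x g})
    fun x _ => by
      refine IsOpen.mem_nhds ?_ fun _ _ => rfl
      have : {y : G → A | ∀ g ∈ K x, y g = x g} = ⋂ g ∈ K x, {y | y g = x g} := by
        ext; simp
      rw [this]
      exact isOpen_biInter_finset fun g _ =>
        (isOpen_discrete ({x g} : Set A)).preimage (continuous_apply (A := fun _ : G => A) g)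
  refine ⟨t.biUnion K, fun x hx => ?_⟩
  obtain ⟨z, hz, hxz⟩ := Set.mem_iUnion₂.1 (ht hx)
  obtain ⟨U, hU, hzU⟩ := hK z (htX z hz)
  refine ⟨U, hU, fun y hy => hzU y fun g hg => ?_⟩
  rw [hy g (Finset.mem_biUnion.2 ⟨z, hz, hg⟩)]
  exact hxz g hg

lemma exists_names_card_le_ncard_patterns [Fintype A] {X : Set (G → A)}
    (hX : ∀ g : G, ∀ x ∈ X, shift g x ∈ X) {𝒰 : Finset (Set (G → A))} {K : Finset G}
    (hK : ∀ x ∈ X, ∃ U ∈ 𝒰, ∀ y : G → A, (∀ g ∈ K, y g = x g) → y ∈ U) (F : Finset G) :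
    ∃ Λ : Finset (G → Set (G → A)), Λ.card ≤ (patterns X (K * F)).ncard ∧
      (∀ u ∈ Λ, ∀ g ∈ F, u g ∈ 𝒰) ∧ X ⊆ ⋃ u ∈ Λ, nameSet F u := by
  rcases X.eq_empty_or_nonempty with rfl | ⟨x₀, -⟩
  · exact ⟨∅, by simp, by simp, by simp⟩
  have : Nonempty (G → A) := ⟨x₀⟩
  choose! U hU hUK using hK
  have hrep : ∀ p ∈ patterns X (K * F), ∃ x ∈ X, (fun g : (K * F : Finset G) => x g) = p :=
    fun p hp => hp
  choose! r hrX hr using hrep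
  have hfin : (patterns X (K * F)).Finite := Set.toFinite _
  refine ⟨hfin.toFinset.image fun p g => U (shift g (r p)), ?_, ?_, ?_⟩
  · rw [Set.ncard_eq_toFinset_card _ hfin]
    exact Finset.card_image_le
  · intro u hu g _
    obtain ⟨p, hp, rfl⟩ := Finset.mem_image.1 hu
    exact hU _ (hX g _ (hrX p (hfin.mem_toFinset.1 hp)))
  · intro y hy
    have hp : (fun g : (K * F : Finset G) => y g) ∈ patterns X (K * F) := ⟨y, hy, rfl⟩
    refine Set.mem_biUnion (Finset.mem_coe.2 (Finset.mem_image_of_mem _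
      (hfin.mem_toFinset.2 hp))) fun g hg => ?_
    refine hUK _ (hX g _ (hrX _ hp)) _ fun k hk => ?_
    exact (congrFun (hr _ hp) ⟨k * g, Finset.mul_mem_mul hk hg⟩).symm

lemma IsFolnerSeq.eventually_card_mul_sdiff_le {F : ℕ → Finset G} (hF : IsFolnerSeq F)
    (K : Finset G) {η : ℝ} (hη : 0 < η) :
    ∀ᶠ n in atTop, (((K * F n) \ F n).card : ℝ) ≤ η * (F n).card := by
  filter_upwards [hF.eventually_card_moveIn_le K⁻¹ hη] with n hn
  refine le_trans ?_ hn
  refine Nat.cast_le.2 (Finset.card_le_card fun g hg => ?_)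
  obtain ⟨hg, hgF⟩ := Finset.mem_sdiff.1 hg
  obtain ⟨k, hk, f, hf, rfl⟩ := Finset.mem_mul.1 hg
  exact mem_moveIn.2 ⟨hgF, k⁻¹, Finset.inv_mem_inv hk, by simpa using hf⟩

lemma topEntropy_le [Fintype A] [TopologicalSpace A] [DiscreteTopology A] {F : ℕ → Finset G}
    (hF : IsFolnerSeq F) (hT : IsTemperedSeq F) {X : Set (G → A)} (hX : IsSubshift X) {s t : ℝ}
    (hs0 : 0 ≤ s) (hst : s < t) (hs : HasSmallCovers F X s) :
    topEntropy F X ≤ ENNReal.ofReal t := by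
  refine iSup₂_le fun 𝒰 h𝒰 => ?_
  obtain ⟨K, hK⟩ := exists_finset_lebesgue hX.1.isCompact h𝒰
  set r := (s + t) / 2 with hr
  have hlog : 0 ≤ Real.log (Fintype.card A) := Real.log_natCast_nonneg _
  set η := (t - r) / (Real.log (Fintype.card A) + 1) with hη
  have hη0 : 0 < η := div_pos (by rw [hr]; linarith) (by positivity)
  have hηlog : η * Real.log (Fintype.card A) ≤ t - r := by
    have : η * (Real.log (Fintype.card A) + 1) = t - r := div_mul_cancel₀ _ (by positivity)
    nlinarith
  refine Filter.limsup_le_of_le (by isBoundedDefault) ?_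
  filter_upwards [eventually_ncard_patterns_le hF hT hX.2 hs0 (show s < r by rw [hr]; linarith) hs,
    hF.eventually_card_mul_sdiff_le K hη0] with n hn hn'
  refine ENNReal.ofReal_le_ofReal ?_
  have hpos : (0 : ℝ) < (F n).card := by exact_mod_cast (hF.1 n).card_pos
  rw [div_le_iff₀ hpos]
  rcases Nat.eq_zero_or_pos (covNum 𝒰 (F n) X) with h0 | h0
  · rw [h0]
    simp only [Nat.cast_zero, Real.log_zero]
    exact mul_nonneg (by linarith) hpos.le
  obtain ⟨Λ, hΛc, hΛ𝒰, hΛX⟩ := exists_names_card_le_ncard_patterns hX.2 hK (F n)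
  have h1 : covNum 𝒰 (F n) X ≤ Λ.card := Nat.sInf_le ⟨Λ, rfl, hΛ𝒰, hΛX⟩
  have h2 := (h1.trans hΛc).trans (ncard_patterns_le_mul X (F n) (K * F n))
  have h3 := h0.trans_le h2
  have hp : 0 < (patterns X (F n)).ncard := Nat.pos_of_mul_pos_right h3
  have hq : 0 < Fintype.card A ^ ((K * F n) \ F n).card := Nat.pos_of_mul_pos_left h3
  calc Real.log (covNum 𝒰 (F n) X)
      ≤ Real.log ((patterns X (F n)).ncard * (Fintype.card A : ℝ) ^ ((K * F n) \ F n).card) := by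
        refine Real.log_le_log (by exact_mod_cast h0) (by exact_mod_cast h2)
    _ = Real.log (patterns X (F n)).ncard +
          ((K * F n) \ F n).card * Real.log (Fintype.card A) := by
        rw [Real.log_mul (by exact_mod_cast hp.ne') (by exact_mod_cast hq.ne'), Real.log_pow]
    _ ≤ r * (F n).card + (η * (F n).card) * Real.log (Fintype.card A) := by
        gcongr
        rw [Real.log_le_iff_le_exp (by exact_mod_cast hp)]
        exact hn
    _ = (r + η * Real.log (Fintype.card A)) * (F n).card := by ring
    _ ≤ t * (F n).card := by
        gcongr
        linarith

end Entropy

section Hausdorff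

lemma tendsto_card_atTop {G : Type*} [Infinite G] {F : ℕ → Finset G} (hF : Monotone F)
    (hexh : ∀ g : G, ∃ n, g ∈ F n) : Tendsto (fun n => (F n).card) atTop atTop := by
  refine tendsto_atTop_atTop_of_monotone (fun _ _ h => Finset.card_le_card (hF h)) fun b => ?_
  obtain ⟨S, hS⟩ := Infinite.exists_subset_card_eq G b
  choose n hn using hexh
  refine ⟨S.sup n, ?_⟩
  rw [← hS]
  exact Finset.card_le_card fun g hg => hF (Finset.le_sup hg) (hn g)

variable {G : Type*} {A : Type*}

lemma subshiftDist_le {F : ℕ → Finset G} (hF : Monotone F) (hexh : ∀ g : G, ∃ n, g ∈ F n)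
    {x y : G → A} {n : ℕ} (h : ∀ g ∈ F n, x g = y g) :
    subshiftDist F x y ≤ Real.exp (-((F n).card : ℝ)) := by
  rw [subshiftDist]
  split_ifs with hxy h0
  · positivity
  · rw [Real.exp_le_exp, neg_le_neg_iff, Nat.cast_le]
    refine Finset.card_le_card (hF (le_csSup ?_ h))
    obtain ⟨g, hg⟩ := Function.ne_iff.1 hxy
    obtain ⟨N, hN⟩ := hexh g
    refine ⟨N, fun m hm => ?_⟩
    by_contra hlt
    exact hg (hm g (hF (not_le.1 hlt).le hN))
  · exact absurd (fun g hg => h g (hF (Nat.zero_le n) hg)) h0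

lemma le_subshiftDist {F : ℕ → Finset G} (hF : Monotone F)
    {x y : G → A} {n : ℕ} (h : ¬ ∀ g ∈ F (n + 1), x g = y g) :
    Real.exp (-((F n).card : ℝ)) ≤ subshiftDist F x y := by
  rw [subshiftDist]
  split_ifs with hxy h0
  · exact absurd (fun g _ => congrFun hxy g) h
  · rw [Real.exp_le_exp, neg_le_neg_iff, Nat.cast_le]
    refine Finset.card_le_card (hF (csSup_le ⟨0, h0⟩ fun m hm => ?_))
    by_contra hlt
    exact h fun g hg => hm g (hF (not_le.1 hlt) hg)
  · rw [Real.exp_le_one_iff]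
    simp

lemma le_subshiftDist' {F : ℕ → Finset G} (hF : Monotone F)
    {x y : G → A} {n : ℕ} (h : ¬ ∀ g ∈ F n, x g = y g) :
    Real.exp (-((F n).card : ℝ)) ≤ subshiftDist F x y :=
  le_subshiftDist hF fun h' => h fun g hg => h' g (hF n.le_succ hg)

lemma ofReal_subshiftDist_le_sdiam (F : ℕ → Finset G) {E : Set (G → A)} {x y : G → A}
    (hx : x ∈ E) (hy : y ∈ E) : ENNReal.ofReal (subshiftDist F x y) ≤ sdiam F E :=
  le_iSup₂_of_le (⟨x, hx⟩ : E) (⟨y, hy⟩ : E) le_rfl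

lemma sdiam_le {F : ℕ → Finset G} (hF : Monotone F) (hexh : ∀ g : G, ∃ n, g ∈ F n)
    {E : Set (G → A)} {n : ℕ} (h : ∀ x ∈ E, ∀ y ∈ E, ∀ g ∈ F n, x g = y g) :
    sdiam F E ≤ ENNReal.ofReal (Real.exp (-((F n).card : ℝ))) :=
  iSup₂_le fun x y => ENNReal.ofReal_le_ofReal
    (subshiftDist_le hF hexh (h x x.2 y y.2))

lemma ofReal_exp_neg_rpow (c s : ℝ) :
    ENNReal.ofReal (Real.exp (-c)) ^ s = ENNReal.ofReal (Real.exp (-s * c)) := by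
  rw [ENNReal.ofReal_rpow_of_pos (Real.exp_pos _), ← Real.exp_mul]
  congr 2
  ring

/-- A set of small diameter lies in a cylinder of essentially the same diameter. -/
lemma exists_cylinder_of_sdiam_le [Infinite G] [Nonempty (G → A)] {F : ℕ → Finset G}
    (hF : Monotone F) (hexh : ∀ g : G, ∃ n, g ∈ F n) {s t : ℝ} (hs : 0 ≤ s) (hst : s < t)
    {E : Set (G → A)} {N : ℕ}
    (hE : sdiam F E ≤ ENNReal.ofReal (Real.exp (-((F N).card : ℝ)) / 2))
    {δ : ℝ≥0∞} (hδ : 0 < δ) :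
    ∃ p : ℕ × (G → A), N ≤ p.1 ∧ E ⊆ cylinder F p.1 p.2 ∧
      ENNReal.ofReal (Real.exp (-t * ((F p.1).card : ℝ))) ≤ sdiam F E ^ s + δ := by
  by_cases hall : ∀ n, ∀ x ∈ E, ∀ y ∈ E, ∀ g ∈ F n, x g = y g
  · have hlim : Tendsto (fun n => ENNReal.ofReal (Real.exp (-t * ((F n).card : ℝ)))) atTop
        (𝓝 0) := by
      rw [← ENNReal.ofReal_zero]
      refine ENNReal.tendsto_ofReal (Real.tendsto_exp_atBot.comp ?_)
      exact (tendsto_natCast_atTop_atTop.comp (tendsto_card_atTop hF hexh)).const_mul_atTop_of_neg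
        (by linarith)
    obtain ⟨n, hn, hnN⟩ := ((hlim.eventually (gt_mem_nhds hδ)).and
      (eventually_ge_atTop N)).exists
    have hω : ∃ ω : G → A, E ⊆ cylinder F n ω := by
      rcases E.eq_empty_or_nonempty with rfl | ⟨ω, hω⟩
      · exact ⟨Classical.arbitrary _, Set.empty_subset _⟩
      · exact ⟨ω, fun x hx => hall n x hx ω hω⟩
    obtain ⟨ω, hω⟩ := hω
    exact ⟨(n, ω), hnN, hω, hn.le.trans le_add_self⟩
  · have hN : ∀ x ∈ E, ∀ y ∈ E, ∀ g ∈ F N, x g = y g := by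
      intro x hx y hy
      by_contra h
      have h1 := (ofReal_subshiftDist_le_sdiam F hx hy).trans hE
      have h2 := (ENNReal.ofReal_le_ofReal_iff (by positivity)).1 h1
      have h3 := le_subshiftDist' hF h
      linarith [Real.exp_pos (-((F N).card : ℝ))]
    push Not at hall
    have hm := Nat.find_spec hall
    have hmin := fun m => Nat.find_min hall (m := m)
    set m := Nat.find hall with hmdef
    obtain ⟨x, hx, y, hy, g, hg, hxy⟩ := hm
    have hNm : N < m := by
      by_contra hle
      exact hxy (hN x hx y hy g (hF (not_lt.1 hle) hg))
    obtain ⟨n, hn⟩ : ∃ n, m = n + 1 := ⟨m - 1, by omega⟩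
    have hn' := hmin n (by omega)
    push Not at hn'
    refine ⟨(n, x), by simp only; omega, fun z hz => hn' z hz x hx, ?_⟩
    have h1 : ENNReal.ofReal (Real.exp (-((F n).card : ℝ))) ≤ sdiam F E := by
      refine (ENNReal.ofReal_le_ofReal (le_subshiftDist hF fun h => ?_)).trans
        (ofReal_subshiftDist_le_sdiam F hx hy)
      exact hxy (h g (hn ▸ hg))
    calc ENNReal.ofReal (Real.exp (-t * ((F n).card : ℝ)))
        ≤ ENNReal.ofReal (Real.exp (-s * ((F n).card : ℝ))) := by
          gcongr
      _ = ENNReal.ofReal (Real.exp (-((F n).card : ℝ))) ^ s := (ofReal_exp_neg_rpow _ _).symm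
      _ ≤ sdiam F E ^ s := ENNReal.rpow_le_rpow h1 hs
      _ ≤ _ := le_self_add

lemma isOpen_cylinder [TopologicalSpace A] [DiscreteTopology A] (F : ℕ → Finset G) (n : ℕ)
    (ω : G → A) : IsOpen (cylinder F n ω) := by
  have : cylinder F n ω = ⋂ g ∈ F n, {y | y g = ω g} := by
    ext; simp [cylinder]
  rw [this]
  exact isOpen_biInter_finset fun g _ =>
    (isOpen_discrete ({ω g} : Set A)).preimage (continuous_apply (A := fun _ : G => A) g)

lemma hasSmallCovers_of_hMeasure_eq_zero [Infinite G] [TopologicalSpace A] [DiscreteTopology A]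
    {F : ℕ → Finset G} (hF : Monotone F) (hexh : ∀ g : G, ∃ n, g ∈ F n) {X : Set (G → A)}
    (hX : IsCompact X) {s t : ℝ} (hs : 0 ≤ s) (hst : s < t) (h : hMeasure F s X = 0) :
    HasSmallCovers F X t := by
  intro θ hθ N
  rcases X.eq_empty_or_nonempty with rfl | ⟨x₀, -⟩
  · exact ⟨∅, by simp, by simp, by simpa using hθ.le⟩
  have : Nonempty (G → A) := ⟨x₀⟩
  have hθ2 : (0 : ℝ≥0∞) < ENNReal.ofReal (θ / 2) := by simpa using hθ
  have hε : (0 : ℝ) < Real.exp (-((F N).card : ℝ)) / 2 := by positivity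
  have h1 := (le_iSup₂ (f := fun (ε : ℝ) (_ : 0 < ε) =>
    ⨅ (𝓔 : Set (Set (G → A))) (_ : 𝓔.Countable) (_ : X ⊆ ⋃₀ 𝓔)
      (_ : ∀ E ∈ 𝓔, sdiam F E ≤ ENNReal.ofReal ε),
      ∑' E : 𝓔, sdiam F (E : Set (G → A)) ^ s) _ hε).trans_lt
    (show hMeasure F s X < ENNReal.ofReal (θ / 2) by rwa [h])
  simp only [iInf_lt_iff] at h1
  obtain ⟨𝓔, h𝓔c, h𝓔X, h𝓔d, h𝓔⟩ := h1
  have := h𝓔c.to_subtype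
  obtain ⟨δ, hδ, hδsum⟩ := ENNReal.exists_pos_sum_of_countable hθ2.ne' 𝓔
  have hp := fun E : 𝓔 => exists_cylinder_of_sdiam_le hF hexh hs hst (h𝓔d E E.2)
    (show (0 : ℝ≥0∞) < δ E by exact_mod_cast hδ E)
  choose p hpN hpE hpδ using hp
  obtain ⟨τ, hτ⟩ := hX.elim_finite_subcover (fun E : 𝓔 => cylinder F (p E).1 (p E).2)
    (fun E => isOpen_cylinder F _ _) fun x hx => by
      obtain ⟨E, hE, hxE⟩ := h𝓔X hx
      exact Set.mem_iUnion.2 ⟨⟨E, hE⟩, hpE ⟨E, hE⟩ hxE⟩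
  refine ⟨τ.image p, ?_, ?_, ?_⟩
  · intro q hq
    obtain ⟨E, _, rfl⟩ := Finset.mem_image.1 hq
    exact hpN E
  · intro x hx
    obtain ⟨E, hE, hxE⟩ := Set.mem_iUnion₂.1 (hτ hx)
    exact Set.mem_iUnion₂.2 ⟨p E, Finset.mem_image_of_mem _ hE, hxE⟩
  · refine (ENNReal.ofReal_le_ofReal_iff hθ.le).1 ?_
    rw [ENNReal.ofReal_sum_of_nonneg fun _ _ => by positivity]
    calc ∑ q ∈ τ.image p, ENNReal.ofReal (Real.exp (-t * ((F q.1).card : ℝ)))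
        ≤ ∑ E ∈ τ, ENNReal.ofReal (Real.exp (-t * ((F (p E).1).card : ℝ))) :=
          Finset.sum_image_le_of_nonneg (fun _ _ => zero_le)
      _ ≤ ∑ E ∈ τ, (sdiam F (E : Set (G → A)) ^ s + δ E) := Finset.sum_le_sum fun E _ => hpδ E
      _ ≤ ∑' E : 𝓔, (sdiam F (E : Set (G → A)) ^ s + δ E) := ENNReal.sum_le_tsum τ
      _ = ∑' E : 𝓔, sdiam F (E : Set (G → A)) ^ s + ∑' E : 𝓔, (δ E : ℝ≥0∞) := ENNReal.tsum_add
      _ ≤ ENNReal.ofReal (θ / 2) + ENNReal.ofReal (θ / 2) := add_le_add h𝓔.le hδsum.le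
      _ = ENNReal.ofReal θ := by
        rw [← ENNReal.ofReal_add (by positivity) (by positivity), add_halves]

variable [Group G] [DecidableEq G]

lemma hMeasure_eq_zero_of_topEntropy_lt [Infinite G] [Fintype A] [TopologicalSpace A]
    [DiscreteTopology A] {F : ℕ → Finset G} (hne : ∀ n, (F n).Nonempty) (hF : Monotone F)
    (hexh : ∀ g : G, ∃ n, g ∈ F n) {X : Set (G → A)} (hX : IsSubshift X) {t s : ℝ≥0}
    (ht : topEntropy F X < t) (hts : t < s) : hMeasure F s X = 0 := by
  set 𝒰 : Finset (Set (G → A)) := Finset.univ.image fun a : A => {x : G → A | x 1 = a} with h𝒰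
  have h𝒰c : IsFiniteOpenCoverOn 𝒰 X := by
    refine ⟨fun V hV => ?_, fun x _ => ?_⟩
    · obtain ⟨a, _, rfl⟩ := Finset.mem_image.1 hV
      exact (isOpen_discrete ({a} : Set A)).preimage (continuous_apply (A := fun _ : G => A) 1)
    · exact ⟨{y | y 1 = x 1}, Finset.mem_coe.2 (Finset.mem_image_of_mem _ (Finset.mem_univ _)),
        rfl⟩
  have hlt : coverEntropyOf F 𝒰 X < t :=
    (le_iSup₂ (f := fun (𝒰 : Finset (Set (G → A))) (_ : IsFiniteOpenCoverOn 𝒰 X) =>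
      coverEntropyOf F 𝒰 X) 𝒰 h𝒰c).trans_lt ht
  have hev := Filter.eventually_lt_of_limsup_lt hlt
  obtain ⟨K, hK⟩ := exists_finset_lebesgue hX.1.isCompact h𝒰c
  have hcard := tendsto_card_atTop hF hexh
  have hlim : Tendsto (fun n => ENNReal.ofReal (Real.exp (-((s : ℝ) - t) * ((F n).card : ℝ))))
      atTop (𝓝 0) := by
    rw [← ENNReal.ofReal_zero]
    refine ENNReal.tendsto_ofReal (Real.tendsto_exp_atBot.comp ?_)
    exact (tendsto_natCast_atTop_atTop.comp hcard).const_mul_atTop_of_neg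
      (by simpa using hts)
  have hdlim : Tendsto (fun n => Real.exp (-((F n).card : ℝ))) atTop (𝓝 0) :=
    Real.tendsto_exp_neg_atTop_nhds_zero.comp (tendsto_natCast_atTop_atTop.comp hcard)
  refine le_antisymm (iSup₂_le fun ε hε => ge_of_tendsto hlim ?_) zero_le
  filter_upwards [hev, hdlim.eventually (gt_mem_nhds hε)] with n hn hnε
  have hpos : (0 : ℝ) < (F n).card := by exact_mod_cast (hne n).card_pos
  obtain ⟨Λ₀, _, hΛ₀⟩ := exists_names_card_le_ncard_patterns hX.2 hK (F n)
  obtain ⟨Λ, hΛc, hΛ𝒰, hΛX⟩ := Nat.sInf_mem (s := {k : ℕ | ∃ Λ : Finset (G → Set (G → A)),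
    Λ.card = k ∧ (∀ u ∈ Λ, ∀ g ∈ F n, u g ∈ 𝒰) ∧ X ⊆ ⋃ u ∈ Λ, nameSet (F n) u})
    ⟨_, Λ₀, rfl, hΛ₀⟩
  have hcov : (covNum 𝒰 (F n) X : ℝ) ≤ Real.exp (t * (F n).card) := by
    rcases Nat.eq_zero_or_pos (covNum 𝒰 (F n) X) with h0 | h0
    · rw [h0, Nat.cast_zero]; positivity
    rw [← Real.log_le_iff_le_exp (by exact_mod_cast h0), ← div_le_iff₀ hpos]
    rw [← ENNReal.ofReal_coe_nnreal] at hn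
    exact ((ENNReal.ofReal_lt_ofReal_iff_of_nonneg
      (div_nonneg (Real.log_natCast_nonneg _) hpos.le)).1 hn).le
  have hdiam : ∀ u ∈ Λ, sdiam F (nameSet (F n) u) ≤
      ENNReal.ofReal (Real.exp (-((F n).card : ℝ))) := by
    intro u hu
    refine sdiam_le hF hexh fun x hx y hy g hg => ?_
    obtain ⟨a, _, ha⟩ := Finset.mem_image.1 (hΛ𝒰 u hu g hg)
    have h1 := hx g hg
    have h2 := hy g hg
    rw [← ha] at h1 h2
    have h3 : x (1 * g) = a := h1
    have h4 : y (1 * g) = a := h2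
    rw [one_mul] at h3 h4
    rw [h3, h4]
  set 𝓔 := Λ.image (nameSet (F n)) with h𝓔
  refine iInf_le_of_le (𝓔 : Set (Set (G → A))) (iInf_le_of_le 𝓔.countable_toSet
    (iInf_le_of_le ?_ (iInf_le_of_le ?_ ?_)))
  · intro x hx
    obtain ⟨u, hu, hxu⟩ := Set.mem_iUnion₂.1 (hΛX hx)
    exact ⟨_, Finset.mem_coe.2 (Finset.mem_image_of_mem _ hu), hxu⟩
  · intro E hE
    obtain ⟨u, hu, rfl⟩ := Finset.mem_image.1 (Finset.mem_coe.1 hE)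
    exact (hdiam u hu).trans (ENNReal.ofReal_le_ofReal hnε.le)
  · calc ∑' E : (𝓔 : Set (Set (G → A))), sdiam F (E : Set (G → A)) ^ (s : ℝ)
        = ∑ E ∈ 𝓔, sdiam F E ^ (s : ℝ) :=
          Finset.tsum_subtype' 𝓔 fun E => sdiam F E ^ (s : ℝ)
      _ ≤ ∑ u ∈ Λ, sdiam F (nameSet (F n) u) ^ (s : ℝ) :=
          Finset.sum_image_le_of_nonneg (fun _ _ => zero_le)
      _ ≤ Λ.card • ENNReal.ofReal (Real.exp (-((F n).card : ℝ))) ^ (s : ℝ) :=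
          Finset.sum_le_card_nsmul _ _ _ fun u hu =>
            ENNReal.rpow_le_rpow (hdiam u hu) s.2
      _ = ENNReal.ofReal (covNum 𝒰 (F n) X * Real.exp (-s * ((F n).card : ℝ))) := by
          rw [ofReal_exp_neg_rpow, hΛc, nsmul_eq_mul, ENNReal.ofReal_mul (by positivity),
            ENNReal.ofReal_natCast]
          rfl
      _ ≤ ENNReal.ofReal (Real.exp (t * (F n).card) * Real.exp (-s * ((F n).card : ℝ))) := by
          gcongr
      _ = _ := by
          rw [← Real.exp_add]
          congr 2
          ring

end Hausdorff

/-- For a subshift `X ⊆ A^G` over a countably infinite (discrete) amenable group `G`,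
with metric associated to a nested tempered Følner sequence `{F n}` exhausting `G`, the
Hausdorff dimension of `X` equals its topological entropy: `dim(X) = h_top(X,G)`. -/
theorem hDim_eq_topEntropy
    {G : Type*} [Group G] [DecidableEq G] [Countable G] [Infinite G]
    {A : Type*} [Fintype A] [TopologicalSpace A] [DiscreteTopology A]
    (Fseq : ℕ → Finset G) (hFol : IsFolnerSeq Fseq) (hTemp : IsTemperedSeq Fseq)
    (hmono : ∀ n, Fseq n ⊆ Fseq (n + 1)) (hexh : ∀ g : G, ∃ n, g ∈ Fseq n)
    (X : Set (G → A)) (hX : IsSubshift X) :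
    hDim Fseq X = topEntropy Fseq X := by
  have hF : Monotone Fseq := monotone_nat_of_le_succ hmono
  refine le_antisymm ?_ (le_iInf₂ fun s hs => ?_)
  · refine le_of_forall_gt_imp_ge_of_dense fun r hr => ?_
    obtain ⟨s, hs, hsr⟩ := ENNReal.lt_iff_exists_nnreal_btwn.1 hr
    obtain ⟨t, ht, hts⟩ := ENNReal.lt_iff_exists_nnreal_btwn.1 hs
    exact (iInf₂_le s (hMeasure_eq_zero_of_topEntropy_lt hFol.1 hF hexh hX ht
      (by exact_mod_cast hts))).trans hsr.le
  · refine ENNReal.le_of_forall_pos_le_add fun ε hε _ => ?_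
    have hε' : (0 : ℝ) < ε := hε
    have h1 : HasSmallCovers Fseq X (s + ε / 2) :=
      hasSmallCovers_of_hMeasure_eq_zero hF hexh hX.1.isCompact s.coe_nonneg (by linarith) hs
    refine (topEntropy_le hFol hTemp hX (t := s + ε) (by positivity) (by linarith) h1).trans
      (le_of_eq ?_)
    rw [ENNReal.ofReal_add s.coe_nonneg ε.coe_nonneg, ENNReal.ofReal_coe_nnreal, ENNReal.ofReal_coe_nnreal]
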